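/- arXiv:1007.4658 — 6 statements merged into one kernel-verified Lean document; each statement's English description precedes it below -/
import Mathlib

section
/- The implicit ideal H := ⋂_{γ ∈ Φ} (𝒫_γ·R̂) is a prime ideal of the M-adic completion R̂ of R. -/
/-!
Statement 0. Let `(R, M)` be a noetherian local domain which is not a field, with field of
fractions `K`, and let `ν : K → ℝ≥0` be a (multiplicatively written) valuation which is ≤ 1 on `R`
and < 1 on `M` (i.e. `ν` is a nontrivial rank-one valuation centered at `R`).  For `γ ∈ ℝ≥0` let
`𝒫_γ = {x ∈ R | ν x ≤ γ}` and let `Φ = ν(R \ {0})`.  Then the implicit ideal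
`H = ⋂_{γ ∈ Φ} 𝒫_γ·R̂` of the `M`-adic completion `R̂` of `R` is prime.
-/

open IsLocalRing
open scoped NNReal

/-- The valuation ideal `𝒫_γ = {x ∈ R | ν (f x) ≤ γ}`, for a valuation `ν` on a ring `K`
and a ring homomorphism `f : R → K` such that `ν ∘ f` is bounded by `1` on `R`. -/
def valIdeal {R K : Type*} [CommRing R] [CommRing K] (f : R →+* K)
    (ν : Valuation K ℝ≥0) (hν : ∀ x : R, ν (f x) ≤ 1) (γ : ℝ≥0) : Ideal R where
  carrier := {x : R | ν (f x) ≤ γ}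
  add_mem' := fun {a b} ha hb => by
    simp only [Set.mem_setOf_eq, map_add] at *
    exact le_trans (ν.map_add _ _) (max_le ha hb)
  zero_mem' := by simp
  smul_mem' := fun c x hx => by
    simp only [smul_eq_mul, Set.mem_setOf_eq, map_mul] at *
    calc ν (f c) * ν (f x) ≤ 1 * γ := mul_le_mul' (hν c) hx
      _ = γ := one_mul γ

/-- The value semigroup `Φ = ν(R \ {0})`. -/
def valSemigroup {R K : Type*} [CommRing R] [CommRing K] (f : R →+* K)
    (ν : Valuation K ℝ≥0) : Set ℝ≥0 :=
  {γ : ℝ≥0 | ∃ x : R, x ≠ 0 ∧ ν (f x) = γ}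

/-- The implicit ideal `H = ⋂_{γ ∈ Φ} 𝒫_γ·R̂` of the `M`-adic completion `R̂` of a local
ring `R`. -/
noncomputable def implicitIdeal {R K : Type*} [CommRing R] [IsLocalRing R] [CommRing K]
    (f : R →+* K) (ν : Valuation K ℝ≥0) (hν : ∀ x : R, ν (f x) ≤ 1) :
    Ideal (AdicCompletion (maximalIdeal R) R) :=
  ⨅ γ ∈ valSemigroup f ν,
    Ideal.map (algebraMap R (AdicCompletion (maximalIdeal R) R)) (valIdeal f ν hν γ)

namespace AdicCompletion

variable {R : Type*} [CommRing R] {I : Ideal R}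

/-- Elements of the completion at a finitely generated ideal are approximated by elements of
the base ring modulo the extension of any power of that ideal. -/
theorem exists_sub_algebraMap_mem_map_pow (hI : I.FG) (n : ℕ) (x : AdicCompletion I R) :
    ∃ a : R, x - algebraMap R (AdicCompletion I R) a ∈
      (I ^ n).map (algebraMap R (AdicCompletion I R)) := by
  obtain ⟨a, ha⟩ := Submodule.mkQ_surjective _ (eval I R n x)
  refine ⟨a, ?_⟩
  have h : x - of I R a ∈ (eval I R n).ker := by
    rw [LinearMap.mem_ker, map_sub, eval_of, ha, sub_self]
  rw [← pow_smul_top_eq_ker_eval hI] at h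
  have key := Ideal.smul_top_eq_map (R := R) (S := AdicCompletion I R) (I ^ n)
  exact key.le h

/-- An ideal containing a power of `I` is the contraction of its extension to the `I`-adic
completion. -/
theorem algebraMap_mem_map_iff {J : Ideal R} {n : ℕ} (hJ : I ^ n ≤ J) {a : R} :
    algebraMap R (AdicCompletion I R) a ∈ J.map (algebraMap R (AdicCompletion I R)) ↔
      a ∈ J := by
  refine ⟨fun h => ?_, Ideal.mem_map_of_mem _⟩
  have h' := Ideal.mem_map_of_mem (evalₐ I n).toRingHom h
  rw [Ideal.map_map, AlgHom.toRingHom_eq_coe, AlgHom.comp_algebraMap, RingHom.coe_coe,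
    AlgHom.commutes] at h'
  exact (Ideal.mem_quotient_iff_mem hJ).1 h'

end AdicCompletion

section valIdeal

variable {R K : Type*} [CommRing R] [CommRing K] {f : R →+* K} {ν : Valuation K ℝ≥0}
  {hν : ∀ x : R, ν (f x) ≤ 1}

theorem mem_valIdeal {γ : ℝ≥0} {x : R} : x ∈ valIdeal f ν hν γ ↔ ν (f x) ≤ γ := Iff.rfl

theorem valIdeal_mono {γ δ : ℝ≥0} (h : γ ≤ δ) : valIdeal f ν hν γ ≤ valIdeal f ν hν δ :=
  fun _ hx => le_trans hx h

theorem valIdeal_pow_le (c : ℝ≥0) (n : ℕ) : valIdeal f ν hν c ^ n ≤ valIdeal f ν hν (c ^ n) := by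
  induction n with
  | zero => exact fun x _ => by simpa [mem_valIdeal] using hν x
  | succ n ih =>
    rw [pow_succ, Ideal.mul_le]
    intro x hx y hy
    rw [mem_valIdeal, map_mul, map_mul, pow_succ]
    exact mul_le_mul' (ih hx) hy

/-- If `ν < 1` on a finitely generated ideal, then every valuation ideal of nonzero value
contains a power of it. -/
theorem exists_pow_le_valIdeal {I : Ideal R} (hI : I.FG) (hνI : ∀ x ∈ I, ν (f x) < 1)
    {γ : ℝ≥0} (hγ : γ ≠ 0) : ∃ n : ℕ, I ^ n ≤ valIdeal f ν hν γ := by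
  obtain ⟨s, rfl⟩ := hI
  have hc : s.sup (fun x => ν (f x)) < 1 :=
    (Finset.sup_lt_iff (by simp)).2 fun x hx => hνI x (Ideal.subset_span hx)
  obtain ⟨n, hn⟩ := exists_pow_lt_of_lt_one (pos_iff_ne_zero.2 hγ) hc
  refine ⟨n, (Ideal.pow_right_mono ?_ n).trans
    ((valIdeal_pow_le (s.sup fun x => ν (f x)) n).trans (valIdeal_mono hn.le))⟩
  exact Ideal.span_le.2 fun x hx => Finset.le_sup (f := fun x => ν (f x)) hx

theorem mul_mem_valSemigroup [IsDomain R] {γ δ : ℝ≥0} (hγ : γ ∈ valSemigroup f ν)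
    (hδ : δ ∈ valSemigroup f ν) : γ * δ ∈ valSemigroup f ν := by
  obtain ⟨x, hx, rfl⟩ := hγ
  obtain ⟨y, hy, rfl⟩ := hδ
  exact ⟨x * y, mul_ne_zero hx hy, by simp⟩

theorem le_one_of_mem_valSemigroup (hν : ∀ x : R, ν (f x) ≤ 1) {γ : ℝ≥0}
    (hγ : γ ∈ valSemigroup f ν) : γ ≤ 1 := by
  obtain ⟨x, -, rfl⟩ := hγ
  exact hν x

theorem ne_zero_of_mem_valSemigroup {L : Type*} [Field L] {g : R →+* L}
    (hg : Function.Injective g) {w : Valuation L ℝ≥0} {γ : ℝ≥0}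
    (hγ : γ ∈ valSemigroup g w) : γ ≠ 0 := by
  obtain ⟨x, hx, rfl⟩ := hγ
  exact (w.ne_zero_iff).2 ((map_ne_zero_iff g hg).2 hx)

theorem mem_implicitIdeal [IsLocalRing R] {x : AdicCompletion (maximalIdeal R) R} :
    x ∈ implicitIdeal f ν hν ↔ ∀ γ ∈ valSemigroup f ν,
      x ∈ (valIdeal f ν hν γ).map (algebraMap R (AdicCompletion (maximalIdeal R) R)) := by
  simp only [implicitIdeal, Ideal.mem_iInf]

end valIdeal

/-- The implicit ideal `H = ⋂_{γ ∈ Φ} 𝒫_γ·R̂` is a prime ideal of the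
`M`-adic completion `R̂` of `R`. -/
theorem implicitIdeal_isPrime
    (R : Type*) [CommRing R] [IsDomain R] [IsNoetherianRing R] [IsLocalRing R]
    (hR : ¬ IsField R)
    (ν : Valuation (FractionRing R) ℝ≥0)
    (hν1 : ∀ x : R, ν (algebraMap R (FractionRing R) x) ≤ 1)
    (hν2 : ∀ x ∈ maximalIdeal R, ν (algebraMap R (FractionRing R) x) < 1) :
    (implicitIdeal (algebraMap R (FractionRing R)) ν hν1).IsPrime := by
  have hfg : (maximalIdeal R).FG := IsNoetherian.noetherian _
  have hinj := IsFractionRing.injective R (FractionRing R)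
  refine Ideal.isPrime_iff.2 ⟨fun htop => ?_, fun {x y} hxy => ?_⟩
  · obtain ⟨m, hm, hm0⟩ := Submodule.exists_mem_ne_zero_of_ne_bot
      (mt IsLocalRing.isField_iff_maximalIdeal_eq.2 hR)
    have hγ : ν (algebraMap R (FractionRing R) m) ∈
        valSemigroup (algebraMap R (FractionRing R)) ν := ⟨m, hm0, rfl⟩
    obtain ⟨n, hn⟩ := exists_pow_le_valIdeal (hν := hν1) hfg hν2
      (ne_zero_of_mem_valSemigroup hinj hγ)
    have h1 := mem_implicitIdeal.1 ((Ideal.eq_top_iff_one _).1 htop) _ hγ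
    rw [← map_one (algebraMap R _), AdicCompletion.algebraMap_mem_map_iff hn, mem_valIdeal,
      map_one, map_one] at h1
    exact (hν2 m hm).not_ge h1
  · by_contra! hcon
    obtain ⟨hx, hy⟩ := hcon
    simp only [mem_implicitIdeal, not_forall] at hx hy
    obtain ⟨γ, hγ, hx⟩ := hx
    obtain ⟨δ, hδ, hy⟩ := hy
    have hγδ := mul_mem_valSemigroup hγ hδ
    obtain ⟨n, hn⟩ := exists_pow_le_valIdeal (hν := hν1) hfg hν2
      (ne_zero_of_mem_valSemigroup hinj hγδ)
    obtain ⟨a, ha⟩ := AdicCompletion.exists_sub_algebraMap_mem_map_pow hfg n x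
    obtain ⟨b, hb⟩ := AdicCompletion.exists_sub_algebraMap_mem_map_pow hfg n y
    replace ha := Ideal.map_mono hn ha
    replace hb := Ideal.map_mono hn hb
    have hva : γ < ν (algebraMap R (FractionRing R) a) := by
      by_contra! h
      refine hx ((Submodule.sub_mem_iff_left _ (Ideal.mem_map_of_mem _ h)).1
        (Ideal.map_mono (valIdeal_mono ?_) ha))
      exact mul_le_of_le_one_right' (le_one_of_mem_valSemigroup hν1 hδ)
    have hvb : δ < ν (algebraMap R (FractionRing R) b) := by
      by_contra! h
      refine hy ((Submodule.sub_mem_iff_left _ (Ideal.mem_map_of_mem _ h)).1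
        (Ideal.map_mono (valIdeal_mono ?_) hb))
      exact mul_le_of_le_one_left' (le_one_of_mem_valSemigroup hν1 hγ)
    have hab : algebraMap R (AdicCompletion (maximalIdeal R) R) (a * b) ∈
        (valIdeal _ ν hν1 (γ * δ)).map (algebraMap R (AdicCompletion (maximalIdeal R) R)) := by
      have hmul := mem_implicitIdeal.1 hxy _ hγδ
      have hdiff := Ideal.mul_sub_mul_mem _ ha hb
      rw [← map_mul] at hdiff
      exact (Submodule.sub_mem_iff_right _ hmul).1 hdiff
    rw [AdicCompletion.algebraMap_mem_map_iff hn, mem_valIdeal, map_mul, map_mul] at hab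
    exact (mul_lt_mul'' hva hvb zero_le zero_le).not_ge hab
end

section
/- There exists exactly one valuation ν̂ on the quotient ring R̂/H with values in ℝ≥0 such that ν̂(z) ≤ 1 for every z ∈ R̂/H and ν̂(π(x)) = ν(x) for every x ∈ R, where π : R → R̂/H is the composite of ι with the quotient projection R̂ → R̂/H. (In other words, ν extends uniquely to a valuation centered at R̂/H.) -/
/-!
Statement context. Let `(R, M)` be a noetherian local domain which is not a field, with field of
fractions `K`, and let `ν : K → ℝ≥0` be a (multiplicatively written) valuation which is ≤ 1 on `R`
and < 1 on `M` (i.e. `ν` is a nontrivial rank-one valuation centered at `R`).  For `γ ∈ ℝ≥0` let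
`𝒫_γ = {x ∈ R | ν x ≤ γ}` and let `Φ = ν(R \ {0})`.  Then the implicit ideal
`H = ⋂_{γ ∈ Φ} 𝒫_γ·R̂` of the `M`-adic completion `R̂` of `R` is prime.
-/

open IsLocalRing
open scoped NNReal

namespace Valuation

open Filter Topology

/-- A valuation which is at most `1` on `R` and less than `1` on a finitely generated ideal is
bounded away from `1` on that ideal. -/
theorem exists_lt_one_forall_mem_le {R : Type*} [CommRing R] (v : Valuation R ℝ≥0)
    (hv : ∀ x, v x ≤ 1) {I : Ideal R} (hI : I.FG) (hvI : ∀ x ∈ I, v x < 1) :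
    ∃ c < 1, ∀ x ∈ I, v x ≤ c := by
  obtain ⟨s, rfl⟩ := hI
  refine ⟨s.sup v, (Finset.sup_lt_iff (by simp)).2 fun x hx => hvI x (Ideal.subset_span hx), ?_⟩
  intro x hx
  have h : Ideal.span (s : Set R) ≤ valIdeal (RingHom.id R) v hv (s.sup v) :=
    Ideal.span_le.2 fun y hy => Finset.le_sup (f := v) hy
  exact h hx

theorem map_le_pow_of_mem_pow {R : Type*} [CommRing R] (v : Valuation R ℝ≥0)
    (hv : ∀ x, v x ≤ 1) {I : Ideal R} {c : ℝ≥0} (hvI : ∀ x ∈ I, v x ≤ c) (n : ℕ) :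
    ∀ x ∈ I ^ n, v x ≤ c ^ n := by
  have h : I ^ n ≤ valIdeal (RingHom.id R) v hv (c ^ n) := by
    induction n with
    | zero => exact fun x _ => (hv x).trans_eq (pow_zero c).symm
    | succ n ih =>
      rw [pow_succ, Ideal.mul_le]
      intro r hr t ht
      change v (r * t) ≤ c ^ (n + 1)
      rw [map_mul, pow_succ]
      exact mul_le_mul' (ih hr) (hvI t ht)
  exact fun x hx => h hx

theorem dist_map_le {R : Type*} [CommRing R] (v : Valuation R ℝ≥0) (a b : R) :
    dist (v a) (v b) ≤ v (a - b) := by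
  have key (a b : R) : v a ≤ v b + v (a - b) := by
    calc v a = v (b + (a - b)) := by rw [add_sub_cancel]
      _ ≤ max (v b) (v (a - b)) := v.map_add _ _
      _ ≤ v b + v (a - b) := max_le (by simp) (by simp)
  have h₁ : (v a : ℝ) ≤ v b + v (a - b) := by exact_mod_cast key a b
  have h₂ : (v b : ℝ) ≤ v a + v (a - b) := by
    rw [v.map_sub_swap a b]
    exact_mod_cast key b a
  rw [NNReal.dist_eq, abs_le]
  constructor <;> linarith

/-- A valuation which is at most `1` on `R` and bounded away from `1` on `I` extends
to the `I`-adic completion of `R`. -/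
theorem exists_extension_adicCompletion {R : Type*} [CommRing R] (v : Valuation R ℝ≥0)
    (hv : ∀ x, v x ≤ 1) {I : Ideal R} {c : ℝ≥0} (hc : c < 1) (hvI : ∀ x ∈ I, v x ≤ c) :
    ∃ w : Valuation (AdicCompletion I R) ℝ≥0, (∀ z, w z ≤ 1) ∧
      ∀ x, w (algebraMap R (AdicCompletion I R) x) = v x := by
  have hpow := v.map_le_pow_of_mem_pow hv hvI
  have happrox (z : AdicCompletion I R) : ∃ y : ℕ → R, ∀ n,
      AdicCompletion.evalₐ I n z = Ideal.Quotient.mk (I ^ n) (y n) := by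
    choose y hy using fun n => Ideal.Quotient.mk_surjective (AdicCompletion.evalₐ I n z)
    exact ⟨y, fun n => (hy n).symm⟩
  have hlim (z : AdicCompletion I R) : ∃ l : ℝ≥0, ∀ y : ℕ → R,
      (∀ n, AdicCompletion.evalₐ I n z = Ideal.Quotient.mk (I ^ n) (y n)) →
        Tendsto (fun n => v (y n)) atTop (𝓝 l) := by
    obtain ⟨y, rfl⟩ := AdicCompletion.mk_surjective I R z
    have hcauchy : CauchySeq fun n => v (y n) := by
      refine cauchySeq_of_le_geometric (c : ℝ) 1 (by exact_mod_cast hc) fun n => ?_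
      have h : y n - y (n + 1) ∈ I ^ n :=
        Ideal.Quotient.eq.1 (AdicCompletion.Ideal.mk_eq_mk I n.le_succ y).symm
      rw [one_mul]
      exact (v.dist_map_le _ _).trans (by exact_mod_cast hpow n _ h)
    obtain ⟨l, hl⟩ := cauchySeq_tendsto_of_complete hcauchy
    refine ⟨l, fun x hx => hl.congr_dist ?_⟩
    refine squeeze_zero (fun _ => dist_nonneg) (fun n => ?_)
      (tendsto_pow_atTop_nhds_zero_of_lt_one c.2 (by exact_mod_cast hc : (c : ℝ) < 1))
    have h : y n - x n ∈ I ^ n := by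
      rw [← Ideal.Quotient.eq, ← hx n, AdicCompletion.evalₐ_mk]
    exact (v.dist_map_le _ _).trans (by exact_mod_cast hpow n _ h)
  choose w hw using hlim
  have hcoe (x : R) : w (algebraMap R (AdicCompletion I R) x) = v x :=
    tendsto_nhds_unique (hw _ (fun _ => x) fun n => by simp) tendsto_const_nhds
  refine ⟨{
    toFun := w
    map_zero' := by simpa using hcoe 0
    map_one' := by simpa using hcoe 1
    map_mul' := fun a b => ?_
    map_add_le_max' := fun a b => ?_ }, fun z => ?_, hcoe⟩
  · obtain ⟨x, hx⟩ := happrox a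
    obtain ⟨y, hy⟩ := happrox b
    refine tendsto_nhds_unique (hw (a * b) (fun n => x n * y n) fun n => ?_) ?_
    · rw [map_mul, map_mul, hx, hy]
    · simpa only [map_mul] using (hw a x hx).mul (hw b y hy)
  · obtain ⟨x, hx⟩ := happrox a
    obtain ⟨y, hy⟩ := happrox b
    refine le_of_tendsto_of_tendsto' (hw (a + b) (fun n => x n + y n) fun n => ?_)
      ((hw a x hx).max (hw b y hy)) fun n => v.map_add _ _
    rw [map_add, map_add, hx, hy]
  · obtain ⟨x, hx⟩ := happrox z
    exact le_of_tendsto' (hw z x hx) fun n => hv _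

/-- Two valuations on the adic completion along a finitely generated ideal `I` which are at most `1`
and agree on `R`, where they are bounded away from `1` on `I`, are equal. -/
theorem ext_adicCompletion {R : Type*} [CommRing R] {I : Ideal R} (hI : I.FG)
    {w w' : Valuation (AdicCompletion I R) ℝ≥0} (hw : ∀ z, w z ≤ 1) (hw' : ∀ z, w' z ≤ 1)
    (h : ∀ x, w (algebraMap R _ x) = w' (algebraMap R _ x)) {c : ℝ≥0} (hc : c < 1)
    (hwI : ∀ x ∈ I, w (algebraMap R _ x) ≤ c) : w = w' := by
  have bound (u : Valuation (AdicCompletion I R) ℝ≥0) (hu : ∀ z, u z ≤ 1)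
      (huI : ∀ x ∈ I, u (algebraMap R _ x) ≤ c) (n : ℕ) (z : AdicCompletion I R)
      (hz : AdicCompletion.eval I R n z = 0) : u z ≤ c ^ n := by
    have hmem : z ∈ (I ^ n • ⊤ : Submodule R (AdicCompletion I R)) := by
      rw [AdicCompletion.pow_smul_top_eq_ker_eval hI]
      exact hz
    refine Submodule.smul_induction_on hmem (fun r hr y _ => ?_)
      fun x y hx hy => (u.map_add x y).trans (max_le hx hy)
    rw [Algebra.smul_def, map_mul]
    exact (mul_le_mul' ((u.comap (algebraMap R _)).map_le_pow_of_mem_pow (fun _ => hu _) huI n r hr)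
      (hu y)).trans_eq (mul_one _)
  refine Valuation.ext fun z => dist_le_zero.1 ?_
  refine ge_of_tendsto' (x := atTop) (f := fun n : ℕ => (c : ℝ) ^ n + (c : ℝ) ^ n) ?_ fun n => ?_
  · simpa using (tendsto_pow_atTop_nhds_zero_of_lt_one c.2 (by exact_mod_cast hc)).add
      (tendsto_pow_atTop_nhds_zero_of_lt_one c.2 (by exact_mod_cast hc : (c : ℝ) < 1))
  · obtain ⟨x, hx⟩ := Submodule.mkQ_surjective _ (AdicCompletion.eval I R n z)
    have hz : AdicCompletion.eval I R n (z - algebraMap R _ x) = 0 := by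
      rw [_root_.map_sub, ← hx, sub_eq_zero]
      rfl
    have h₁ := bound w hw hwI n _ hz
    have h₂ := bound w' hw' (fun x hx => h x ▸ hwI x hx) n _ hz
    rw [w'.map_sub_swap] at h₂
    refine (dist_triangle (w z) (w (algebraMap R _ x)) (w' z)).trans (add_le_add ?_ ?_)
    · exact (w.dist_map_le _ _).trans (by exact_mod_cast h₁)
    · rw [h]
      exact (w'.dist_map_le _ _).trans (by exact_mod_cast h₂)

end Valuation

/-- The implicit ideal is contained in the support of every valuation on the completion which is at
most `1` and extends `ν`. -/
theorem implicitIdeal_le_supp {R K : Type*} [CommRing R] [IsDomain R] [IsLocalRing R] [CommRing K]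
    (hR : ¬ IsField R) (f : R →+* K) (ν : Valuation K ℝ≥0) (hν : ∀ x : R, ν (f x) ≤ 1)
    (hν' : ∀ x ∈ maximalIdeal R, ν (f x) < 1)
    (w : Valuation (AdicCompletion (maximalIdeal R) R) ℝ≥0) (hw : ∀ z, w z ≤ 1)
    (hwν : ∀ x, w (algebraMap R _ x) = ν (f x)) : implicitIdeal f ν hν ≤ w.supp := by
  intro z hz
  obtain ⟨m, hm, hm0⟩ := Submodule.exists_mem_ne_zero_of_ne_bot
    (mt IsLocalRing.isField_iff_maximalIdeal_eq.2 hR)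
  have hle (n : ℕ) : w z ≤ ν (f m) ^ n := by
    have hmem : ν (f m) ^ n ∈ valSemigroup f ν := ⟨m ^ n, pow_ne_zero n hm0, by simp⟩
    have hz' := (Submodule.mem_iInf _).1 ((Submodule.mem_iInf _).1 hz (ν (f m) ^ n)) hmem
    have hmap : Ideal.map (algebraMap R _) (valIdeal f ν hν (ν (f m) ^ n)) ≤
        valIdeal (RingHom.id _) w hw (ν (f m) ^ n) :=
      Ideal.map_le_iff_le_comap.2 fun x hx => (hwν x).trans_le hx
    exact hmap hz'
  rw [Valuation.mem_supp_iff]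
  exact le_antisymm (ge_of_tendsto'
    (NNReal.tendsto_pow_atTop_nhds_zero_of_lt_one (hν' m hm)) hle) zero_le

/-- There exists exactly one valuation `ν̂` on `R̂/H` with values in `ℝ≥0`
such that `ν̂(z) ≤ 1` for every `z ∈ R̂/H` and `ν̂(π(x)) = ν(x)` for every `x ∈ R`, where
`π : R → R̂/H` is the composite of the completion map with the quotient projection. -/
theorem unique_valuation_extension_to_completion
    (R : Type*) [CommRing R] [IsDomain R] [IsNoetherianRing R] [IsLocalRing R]
    (hR : ¬ IsField R)
    (ν : Valuation (FractionRing R) ℝ≥0)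
    (hν1 : ∀ x : R, ν (algebraMap R (FractionRing R) x) ≤ 1)
    (hν2 : ∀ x ∈ maximalIdeal R, ν (algebraMap R (FractionRing R) x) < 1) :
    ∃! w : Valuation
        (AdicCompletion (maximalIdeal R) R ⧸ implicitIdeal (algebraMap R (FractionRing R)) ν hν1)
        ℝ≥0,
      (∀ z, w z ≤ 1) ∧
      ∀ x : R,
        w (Ideal.Quotient.mk (implicitIdeal (algebraMap R (FractionRing R)) ν hν1)
            (algebraMap R (AdicCompletion (maximalIdeal R) R) x)) =
          ν (algebraMap R (FractionRing R) x) := by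
  have hfg : (maximalIdeal R).FG := IsNoetherian.noetherian _
  let v : Valuation R ℝ≥0 := ν.comap (algebraMap R (FractionRing R))
  obtain ⟨c, hc, hvc⟩ := v.exists_lt_one_forall_mem_le hν1 hfg hν2
  obtain ⟨w, hw, hwv⟩ := v.exists_extension_adicCompletion hν1 hc hvc
  refine ⟨w.onQuot (implicitIdeal_le_supp hR _ ν hν1 hν2 w hw hwv), ⟨?_, hwv⟩, ?_⟩
  · intro z
    obtain ⟨z, rfl⟩ := Ideal.Quotient.mk_surjective z
    exact hw z
  · rintro u ⟨hu, huv⟩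
    have huw : u.comap (Ideal.Quotient.mk _) = w :=
      Valuation.ext_adicCompletion hfg (fun _ => hu _) hw (fun x => (huv x).trans (hwv x).symm) hc
        fun x hx => (huv x).trans_le (hvc x hx)
    refine Valuation.ext fun z => ?_
    obtain ⟨z, rfl⟩ := Ideal.Quotient.mk_surjective z
    exact congrArg (fun t : Valuation _ ℝ≥0 => t z) huw
end

section
/- The contraction of the implicit ideal H along ι : R → R̂ is the zero ideal of R, i.e. ι⁻¹(H) = (0); consequently R embeds into R̂/H. -/
/-!
Statement context. Let `(R, M)` be a noetherian local domain which is not a field, with field of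
fractions `K`, and let `ν : K → ℝ≥0` be a (multiplicatively written) valuation which is ≤ 1 on `R`
and < 1 on `M` (i.e. `ν` is a nontrivial rank-one valuation centered at `R`).  For `γ ∈ ℝ≥0` let
`𝒫_γ = {x ∈ R | ν x ≤ γ}` and let `Φ = ν(R \ {0})`.  Then the implicit ideal
`H = ⋂_{γ ∈ Φ} 𝒫_γ·R̂` of the `M`-adic completion `R̂` of `R` is prime.
-/

open IsLocalRing
open scoped NNReal

/-- Ideals of a noetherian local ring are contracted from its completion. -/
theorem comap_map_algebraMap_adicCompletion {R : Type*} [CommRing R] [IsNoetherianRing R]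
    [IsLocalRing R] (I : Ideal R) :
    (I.map (algebraMap R (AdicCompletion (maximalIdeal R) R))).comap
      (algebraMap R (AdicCompletion (maximalIdeal R) R)) = I := by
  refine le_antisymm (fun x hx => ?_) Ideal.le_comap_map
  have hsup (n : ℕ) : x ∈ I ⊔ maximalIdeal R ^ n := by
    have h := Ideal.mem_map_of_mem (AdicCompletion.evalₐ (maximalIdeal R) n).toRingHom
      (Ideal.mem_comap.1 hx)
    rw [Ideal.map_map, AlgHom.toRingHom_eq_coe, AlgHom.comp_algebraMap,
      Ideal.Quotient.algebraMap_eq] at h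
    have h' : x ∈ (I.map (Ideal.Quotient.mk (maximalIdeal R ^ n))).comap
        (Ideal.Quotient.mk (maximalIdeal R ^ n)) := by
      rw [Ideal.mem_comap]
      convert h using 1
      exact ((AdicCompletion.evalₐ (maximalIdeal R) n).commutes x).symm
    rwa [Ideal.comap_map_of_surjective _ Ideal.Quotient.mk_surjective, ← RingHom.ker_eq_comap_bot,
      Ideal.mk_ker] at h'
  rw [← Ideal.Quotient.eq_zero_iff_mem]
  refine IsHausdorff.haus (I := maximalIdeal R) (M := R ⧸ I) inferInstance _ fun n => ?_
  rw [SModEq.zero]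
  obtain ⟨y, hy, z, hz, rfl⟩ := Submodule.mem_sup.1 (hsup n)
  rw [map_add, Ideal.Quotient.eq_zero_iff_mem.2 hy, zero_add]
  have hz1 : Ideal.Quotient.mk I z = z • (1 : R ⧸ I) := by
    rw [Algebra.smul_def, mul_one]; rfl
  rw [hz1]
  exact Submodule.smul_mem_smul hz Submodule.mem_top

/-- The contraction of the implicit ideal `H` along the completion map
`ι : R → R̂` is the zero ideal of `R`; consequently `R` embeds into `R̂/H`. -/
theorem implicitIdeal_comap_eq_bot
    (R : Type*) [CommRing R] [IsDomain R] [IsNoetherianRing R] [IsLocalRing R]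
    (hR : ¬ IsField R)
    (ν : Valuation (FractionRing R) ℝ≥0)
    (hν1 : ∀ x : R, ν (algebraMap R (FractionRing R) x) ≤ 1)
    (hν2 : ∀ x ∈ maximalIdeal R, ν (algebraMap R (FractionRing R) x) < 1) :
    Ideal.comap (algebraMap R (AdicCompletion (maximalIdeal R) R))
        (implicitIdeal (algebraMap R (FractionRing R)) ν hν1) = ⊥ ∧
    Function.Injective (fun x : R =>
      Ideal.Quotient.mk (implicitIdeal (algebraMap R (FractionRing R)) ν hν1)
        (algebraMap R (AdicCompletion (maximalIdeal R) R) x)) := by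
  have hcomap : Ideal.comap (algebraMap R (AdicCompletion (maximalIdeal R) R))
      (implicitIdeal (algebraMap R (FractionRing R)) ν hν1) = ⊥ := by
    refine (Submodule.eq_bot_iff _).2 fun x hx => by_contra fun hx0 => ?_
    obtain ⟨m, hm, hm0⟩ := Submodule.exists_mem_ne_zero_of_ne_bot
      (mt isField_iff_maximalIdeal_eq.2 hR)
    have hmem : x ∈ valIdeal (algebraMap R (FractionRing R)) ν hν1
        (ν (algebraMap R (FractionRing R) (m * x))) := by
      rw [← comap_map_algebraMap_adicCompletion (valIdeal _ ν hν1 _)]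
      rw [Ideal.mem_comap, implicitIdeal] at hx
      simp only [Submodule.mem_iInf] at hx
      exact hx _ ⟨m * x, mul_ne_zero hm0 hx0, rfl⟩
    have hle : ν (algebraMap R (FractionRing R) x) ≤
        ν (algebraMap R (FractionRing R) (m * x)) := hmem
    have hpos : 0 < ν (algebraMap R (FractionRing R) x) := by
      rw [pos_iff_ne_zero, Valuation.ne_zero_iff]
      exact (map_ne_zero_iff _ (IsFractionRing.injective R (FractionRing R))).2 hx0
    rw [map_mul, map_mul] at hle
    exact hle.not_gt (mul_lt_of_lt_one_left hpos (hν2 m hm))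
  refine ⟨hcomap, ?_⟩
  change Function.Injective ((Ideal.Quotient.mk
    (implicitIdeal (algebraMap R (FractionRing R)) ν hν1)).comp
      (algebraMap R (AdicCompletion (maximalIdeal R) R)))
  rw [RingHom.injective_iff_ker_eq_bot, ← RingHom.comap_ker, Ideal.mk_ker, hcomap]
end

section
/- Let F be a field, V a valuation subring of F with maximal ideal m_V, and R ⊆ V a noetherian local subring whose maximal ideal is m_V ∩ R. Let 𝔭 be a prime ideal of V and P := 𝔭 ∩ R. Let T be a finitely generated (R/P)-subalgebra of V/𝔭 and let q := (m_V/𝔭) ∩ T be the contraction to T of the image of m_V in V/𝔭. Then there exists a subring R' with R ⊆ R' ⊆ V such that: R' is the localization of a finitely generated R-subalgebra A of V at the prime ideal m_V ∩ A; R' is local with maximal ideal m_V ∩ R'; and the quotient R'/(𝔭 ∩ R') is isomorphic as an (R/P)-algebra to the localization T_q. -/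
/-!
Statement 15. Let `F` be a field, `V` a valuation subring of `F` with maximal ideal `m_V`,
and `R ⊆ V` a noetherian local subring whose maximal ideal is `m_V ∩ R`.  Let `𝔭` be a prime
ideal of `V` and `P = 𝔭 ∩ R`.  Let `T` be a finitely generated `(R/P)`-subalgebra of `V/𝔭`
and `q = (m_V/𝔭) ∩ T`.  Then there exists a subring `R'` with `R ⊆ R' ⊆ V` such that `R'`
is the localization of a finitely generated `R`-subalgebra `A` of `V` at the prime ideal
`m_V ∩ A`, `R'` is local with maximal ideal `m_V ∩ R'`, and `R'/(𝔭 ∩ R')` is isomorphic as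
an `(R/P)`-algebra to the localization `T_q`.

Membership of an element `x` of `F` in `m_V` is expressed by `V.valuation x < 1`; in
particular for a subring `S ⊆ V` the ideal `m_V ∩ S` has underlying set
`{x ∈ S | V.valuation x < 1}`.
-/

set_option synthInstance.maxHeartbeats 1000000
set_option maxHeartbeats 2000000

open IsLocalRing

/-- The inclusion homomorphism of a subring `S` of `F` contained in a valuation subring `V`
of `F`. -/
def subringToValuationSubring {F : Type*} [Field F] (V : ValuationSubring F) (S : Subring F)
    (h : (S : Set F) ⊆ (V : Set F)) : S →+* V where
  toFun x := ⟨(x : F), h x.2⟩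
  map_one' := rfl
  map_mul' _ _ := rfl
  map_zero' := rfl
  map_add' _ _ := rfl

/-- The localization of a subring `A` of a valuation subring `V` of `F` at the prime ideal
`m_V ∩ A`, as a subring of `F`. -/
def Subring.localizationInValuationSubring {F : Type*} [Field F] (V : ValuationSubring F)
    (A : Subring F) : Subring F where
  carrier := {x : F | ∃ a b : F, a ∈ A ∧ b ∈ A ∧ ¬ V.valuation b < 1 ∧ x = a / b}
  one_mem' := ⟨1, 1, A.one_mem, A.one_mem, by simp, by simp⟩
  zero_mem' := ⟨0, 1, A.zero_mem, A.one_mem, by simp, by simp⟩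
  mul_mem' := by
    rintro _ _ ⟨a, b, ha, hb, hb1, rfl⟩ ⟨c, d, hc, hd, hd1, rfl⟩
    refine ⟨a * c, b * d, A.mul_mem ha hc, A.mul_mem hb hd, ?_, div_mul_div_comm _ _ _ _⟩
    rw [not_lt] at *
    rw [map_mul]
    exact one_le_mul hb1 hd1
  add_mem' := by
    rintro _ _ ⟨a, b, ha, hb, hb1, rfl⟩ ⟨c, d, hc, hd, hd1, rfl⟩
    have hb0 : b ≠ 0 := by rintro rfl; simp at hb1
    have hd0 : d ≠ 0 := by rintro rfl; simp at hd1
    refine ⟨a * d + b * c, b * d, A.add_mem (A.mul_mem ha hd) (A.mul_mem hb hc),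
      A.mul_mem hb hd, ?_, div_add_div _ _ hb0 hd0⟩
    rw [not_lt] at *
    rw [map_mul]
    exact one_le_mul hb1 hd1
  neg_mem' := by
    rintro _ ⟨a, b, ha, hb, hb1, rfl⟩
    exact ⟨-a, b, A.neg_mem ha, hb, hb1, (neg_div _ _).symm⟩

namespace Subring

variable {F : Type*} [Field F] {V : ValuationSubring F} {A : Subring F}

theorem mem_localizationInValuationSubring {x : F} :
    x ∈ A.localizationInValuationSubring V ↔
      ∃ a b : F, a ∈ A ∧ b ∈ A ∧ ¬ V.valuation b < 1 ∧ x = a / b :=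
  Iff.rfl

theorem le_localizationInValuationSubring : A ≤ A.localizationInValuationSubring V :=
  fun x hx => ⟨x, 1, hx, A.one_mem, by simp, by simp⟩

theorem localizationInValuationSubring_subset (hAV : (A : Set F) ⊆ V) :
    (A.localizationInValuationSubring V : Set F) ⊆ V := by
  rintro _ ⟨a, b, ha, -, hb1, rfl⟩
  rw [SetLike.mem_coe, ← V.valuation_le_one_iff, map_div₀]
  exact div_le_one_of_le₀ (((V.valuation_le_one_iff a).2 (hAV ha)).trans (not_lt.1 hb1)) zero_le

theorem inv_mem_localizationInValuationSubring {x : F}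
    (hx : x ∈ A.localizationInValuationSubring V) (hAV : (A : Set F) ⊆ V)
    (hx1 : ¬ V.valuation x < 1) : x⁻¹ ∈ A.localizationInValuationSubring V := by
  obtain ⟨a, b, ha, hb, hb1, rfl⟩ := hx
  refine ⟨b, a, hb, ha, fun h => hx1 ?_, inv_div _ _⟩
  have hb2 : V.valuation b = 1 :=
    le_antisymm ((V.valuation_le_one_iff b).2 (hAV hb)) (not_lt.1 hb1)
  rwa [map_div₀, hb2, div_one]

theorem mem_nonunits_localizationInValuationSubring_iff (hAV : (A : Set F) ⊆ V)
    (x : A.localizationInValuationSubring V) :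
    x ∈ nonunits (A.localizationInValuationSubring V) ↔ V.valuation (x : F) < 1 := by
  rw [mem_nonunits_iff, ← not_iff_not, not_not]
  constructor
  · rintro h hx
    obtain ⟨y, hy⟩ := h.exists_right_inv
    have hy1 := (V.valuation_le_one_iff _).2 (localizationInValuationSubring_subset hAV y.2)
    have hxy : V.valuation (x : F) * V.valuation (y : F) = 1 := by
      rw [← map_mul, ← Subring.coe_mul, hy, Subring.coe_one, map_one]
    exact (mul_lt_one_of_lt_of_le hx hy1).ne hxy
  · intro hx
    have hx0 : (x : F) ≠ 0 := by intro h; simp [h] at hx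
    exact IsUnit.of_mul_eq_one ⟨_, inv_mem_localizationInValuationSubring x.2 hAV hx⟩
      (Subtype.ext (mul_inv_cancel₀ hx0))

theorem isLocalRing_localizationInValuationSubring (hAV : (A : Set F) ⊆ V) :
    IsLocalRing (A.localizationInValuationSubring V) :=
  IsLocalRing.of_nonunits_add fun x y hx hy => by
    rw [mem_nonunits_localizationInValuationSubring_iff hAV] at *
    exact V.valuation.map_add_lt hx hy

end Subring

/-- Two ring homomorphisms to the same ring with the same range, the second one injective,
induce an isomorphism from the quotient by the kernel of the first to the source of the second. -/
theorem exists_quotient_ringEquiv_of_range_eq {S L K : Type*} [CommRing S] [CommRing L]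
    [CommRing K] (φ : S →+* K) (ψ : L →+* K) (hψ : Function.Injective ψ)
    (h : φ.range = ψ.range) (I : Ideal S) (hI : I = RingHom.ker φ) :
    ∃ e : S ⧸ I ≃+* L, ∀ x, ψ (e (Ideal.Quotient.mk I x)) = φ x := by
  subst hI
  have hψ' : Function.Bijective ψ.rangeRestrict :=
    ⟨fun a b hab => hψ (congrArg Subtype.val hab), ψ.rangeRestrict_surjective⟩
  let eψ := RingEquiv.ofBijective ψ.rangeRestrict hψ'
  refine ⟨((RingHom.quotientKerEquivRange φ).trans (RingEquiv.subringCongr h)).trans eψ.symm,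
    fun x => ?_⟩
  exact congrArg Subtype.val (eψ.apply_symm_apply
    (RingEquiv.subringCongr h (RingHom.quotientKerEquivRange φ (Ideal.Quotient.mk _ x))))

/-- Lifting a finitely generated extension of `R/P` inside `V/𝔭` to a
`ν`-extension `R'` of `R` inside `V`. -/
theorem exists_subring_lifting_residue_extension
    (F : Type*) [Field F] (V : ValuationSubring F)
    (R : Subring F) (hRV : (R : Set F) ⊆ (V : Set F))
    [IsNoetherianRing R] [IsLocalRing R]
    (hmax : ∀ x : R, x ∈ maximalIdeal R ↔ V.valuation (x : F) < 1)
    (𝔭 : Ideal V) [𝔭.IsPrime]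
    (T : Subring (V ⧸ 𝔭))
    (hT : Set.range ((Ideal.Quotient.mk 𝔭).comp (subringToValuationSubring V R hRV)) ⊆
      (T : Set (V ⧸ 𝔭)))
    (hTfg : ∃ s : Finset (V ⧸ 𝔭),
      T = Subring.closure
        (Set.range ((Ideal.Quotient.mk 𝔭).comp (subringToValuationSubring V R hRV)) ∪ s))
    (q : Ideal T)
    (hq : q = Ideal.comap T.subtype
      (Ideal.map (Ideal.Quotient.mk 𝔭) (maximalIdeal V)))
    [q.IsPrime] :
    ∃ (A R' : Subring F) (hAV : (A : Set F) ⊆ (V : Set F))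
      (hRR' : (R : Set F) ⊆ (R' : Set F)) (hR'V : (R' : Set F) ⊆ (V : Set F)),
      -- `A` is a finitely generated `R`-subalgebra of `V`:
      (∃ s : Finset F, (↑s : Set F) ⊆ (V : Set F) ∧
        A = Subring.closure ((R : Set F) ∪ ↑s)) ∧
      -- `R'` is the localization of `A` at the prime ideal `m_V ∩ A`:
      ((R' : Set F) =
        {x : F | ∃ a b : F, a ∈ A ∧ b ∈ A ∧ ¬ V.valuation b < 1 ∧ x = a / b}) ∧
      -- `R'` is local with maximal ideal `m_V ∩ R'`:
      IsLocalRing R' ∧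
      (∀ hloc : IsLocalRing R',
        ∀ x : R', x ∈ maximalIdeal R' ↔ V.valuation (x : F) < 1) ∧
      -- `R'/(𝔭 ∩ R')` is isomorphic to `T_q` as an `(R/P)`-algebra:
      ∃ e : (R' ⧸ Ideal.comap (subringToValuationSubring V R' hR'V) 𝔭) ≃+*
          Localization.AtPrime q,
        ∀ x : R,
          e (Ideal.Quotient.mk (Ideal.comap (subringToValuationSubring V R' hR'V) 𝔭)
              ⟨(x : F), hRR' x.2⟩) =
            algebraMap T (Localization.AtPrime q)
              ⟨(Ideal.Quotient.mk 𝔭).comp (subringToValuationSubring V R hRV) x,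
                hT (Set.mem_range_self x)⟩ := by
  classical
  have hmem : ∀ (v : V) (hv : Ideal.Quotient.mk 𝔭 v ∈ T),
      (⟨_, hv⟩ : T) ∈ q ↔ V.valuation (v : F) < 1 := by
    intro v hv
    rw [hq, ← V.valuation_lt_one_iff, Ideal.mem_comap]
    change Ideal.Quotient.mk 𝔭 v ∈ _ ↔ _
    rw [← Ideal.mem_comap, Ideal.comap_map_of_surjective' _ Ideal.Quotient.mk_surjective,
      Ideal.mk_ker, sup_eq_left.2 (le_maximalIdeal ‹𝔭.IsPrime›.ne_top)]
  have hunit : ∀ y : q.primeCompl, IsUnit (T.subtype y) := by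
    rintro ⟨⟨y, hyT⟩, hy⟩
    obtain ⟨v, rfl⟩ := Ideal.Quotient.mk_surjective y
    have hv : IsUnit v := by
      by_contra h
      exact hy ((hmem v hyT).2 ((V.valuation_lt_one_iff v).1 h))
    exact hv.map (Ideal.Quotient.mk 𝔭)
  let ψ : Localization.AtPrime q →+* V ⧸ 𝔭 := IsLocalization.lift hunit
  have hψ_alg : ∀ t : T, ψ (algebraMap T _ t) = t := fun t => IsLocalization.lift_eq hunit t
  have hψ : Function.Injective ψ := by
    refine (IsLocalization.lift_injective_iff hunit).2 fun x y => ?_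
    rw [(IsLocalization.injective (Localization.AtPrime q)
      q.primeCompl_le_nonZeroDivisors).eq_iff, T.subtype_injective.eq_iff]
  obtain ⟨s, hs⟩ := hTfg
  let g : V ⧸ 𝔭 → V := Function.surjInv Ideal.Quotient.mk_surjective
  have hg : ∀ y, Ideal.Quotient.mk 𝔭 (g y) = y := Function.surjInv_eq _
  let B : Subring V := Subring.closure (Set.range (subringToValuationSubring V R hRV) ∪ g '' s)
  have hBT : B.map (Ideal.Quotient.mk 𝔭) = T := by
    rw [hs, RingHom.map_closure, Set.image_union, ← Set.range_comp, Set.image_image]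
    simp only [hg, Set.image_id']
    rfl
  let A : Subring F := B.map V.subtype
  have hA : A = Subring.closure ((R : Set F) ∪ ↑(s.image fun y => (g y : F))) := by
    change Subring.map _ _ = _
    rw [RingHom.map_closure, Set.image_union, ← Set.range_comp, Set.image_image,
      Finset.coe_image]
    congr 2
    exact Subtype.range_coe
  have hAV : (A : Set F) ⊆ V := by
    rintro _ ⟨v, -, rfl⟩
    exact v.2
  have hRA : R ≤ A := by
    rw [hA]
    exact fun x hx => Subring.subset_closure (Or.inl hx)
  have hR'V := Subring.localizationInValuationSubring_subset hAV
  let φ := (Ideal.Quotient.mk 𝔭).comp (subringToValuationSubring V _ hR'V)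
  have hBT' : ∀ v ∈ B, Ideal.Quotient.mk 𝔭 v ∈ T := fun v hv => hBT ▸ ⟨v, hv, rfl⟩
  have key : ∀ (a b c : V) (ha : a ∈ B) (hb : b ∈ B) (hb1 : ¬ V.valuation (b : F) < 1),
      (c : F) = a / b → Ideal.Quotient.mk 𝔭 c =
        ψ (IsLocalization.mk' _ (⟨_, hBT' a ha⟩ : T)
          (⟨⟨_, hBT' b hb⟩, fun h => hb1 ((hmem b _).1 h)⟩ : q.primeCompl)) := by
    intro a b c ha hb hb1 hc
    have hb0 : (b : F) ≠ 0 := by intro h; simp [h] at hb1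
    have hcb : b * c = a := Subtype.ext (by
      rw [MulMemClass.coe_mul, hc, mul_div_cancel₀ _ hb0])
    refine ((IsLocalization.lift_mk'_spec _ _ _ _).2 ?_).symm
    exact (congrArg (Ideal.Quotient.mk 𝔭) hcb.symm).trans (map_mul _ _ _)
  have hrange : φ.range = ψ.range := by
    apply le_antisymm
    · rintro _ ⟨⟨x, hx⟩, rfl⟩
      obtain ⟨_, _, ⟨a, ha, rfl⟩, ⟨b, hb, rfl⟩, hb1, h⟩ := id hx
      exact ⟨_, (key a b ⟨x, hR'V hx⟩ ha hb hb1 h).symm⟩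
    · rintro _ ⟨z, rfl⟩
      obtain ⟨⟨t, ht⟩, ⟨⟨u, hu⟩, hu'⟩, rfl⟩ := IsLocalization.exists_mk'_eq q.primeCompl z
      obtain ⟨a, ha, rfl⟩ := hBT.ge ht
      obtain ⟨b, hb, rfl⟩ := hBT.ge hu
      have hb1 : ¬ V.valuation (b : F) < 1 := fun h => hu' ((hmem b hu).2 h)
      have hx : (a / b : F) ∈ A.localizationInValuationSubring V :=
        ⟨a, b, ⟨a, ha, rfl⟩, ⟨b, hb, rfl⟩, hb1, rfl⟩
      exact ⟨⟨_, hx⟩, key a b ⟨_, hR'V hx⟩ ha hb hb1 rfl⟩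
  refine ⟨A, A.localizationInValuationSubring V, hAV,
    fun x hx => Subring.le_localizationInValuationSubring (hRA hx), hR'V,
    ⟨_, ?_, hA⟩, rfl, Subring.isLocalRing_localizationInValuationSubring hAV,
    fun _ x => Subring.mem_nonunits_localizationInValuationSubring_iff hAV x, ?_⟩
  · intro x hx
    obtain ⟨y, -, rfl⟩ := Finset.mem_image.1 hx
    exact (g y).2
  · obtain ⟨e, he⟩ := exists_quotient_ringEquiv_of_range_eq φ ψ hψ hrange
      (Ideal.comap (subringToValuationSubring V _ hR'V) 𝔭)
      (by rw [← RingHom.comap_ker, Ideal.mk_ker])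
    exact ⟨e, fun x => hψ (by rw [he, hψ_alg]; rfl)⟩
end

section
/- Let k₀ be a field, (S, m, k) a noetherian local k₀-algebra with maximal ideal m and residue field k, and k₀ ⊆ L a field extension such that the ring k ⊗_{k₀} L is an integral domain. Then the extension m·(S ⊗_{k₀} L) is a prime ideal of S ⊗_{k₀} L, and the localization S(L) := (S ⊗_{k₀} L)_{m·(S ⊗_{k₀} L)} of S ⊗_{k₀} L at this prime is a noetherian local ring. -/
/-!
Statement 16. Let `k₀` be a field, `(S, m, k)` a noetherian local `k₀`-algebra and
`k₀ ⊆ L` a field extension such that `k ⊗[k₀] L` is an integral domain.  Then the extension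
`m·(S ⊗[k₀] L)` is a prime ideal of `S ⊗[k₀] L`, and the localization
`S(L) = (S ⊗[k₀] L)_{m·(S ⊗[k₀] L)}` is a noetherian local ring.
-/

open IsLocalRing
open scoped TensorProduct

/-- The extension `m·(S ⊗[k₀] L)` of the maximal ideal of `S` to `S ⊗[k₀] L`. -/
noncomputable def extendedMaxIdeal (k₀ S L : Type*) [Field k₀] [CommRing S] [Algebra k₀ S]
    [IsLocalRing S] [CommRing L] [Algebra k₀ L] : Ideal (S ⊗[k₀] L) :=
  Ideal.map (Algebra.TensorProduct.includeLeft : S →ₐ[k₀] S ⊗[k₀] L).toRingHom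
    (maximalIdeal S)

/-- A local ring with finitely generated maximal ideal `M` is noetherian as soon as every finitely
generated ideal is closed in the `M`-adic topology. -/
theorem isNoetherianRing_of_fg_ideal_closed {A : Type*} [CommRing A] [IsLocalRing A]
    (hM : (maximalIdeal A).FG)
    (hcl : ∀ I : Ideal A, I.FG → ∀ x : A, (∀ n : ℕ, x ∈ I ⊔ maximalIdeal A ^ n) → x ∈ I) :
    IsNoetherianRing A := by
  by_contra hA
  obtain ⟨I₀, hI₀⟩ : ∃ I : Ideal A, ¬ I.FG := by
    by_contra! h
    exact hA ⟨h⟩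
  obtain ⟨I, hI⟩ : ∃ I : Ideal A, Maximal (fun J : Ideal A ↦ ¬ J.FG) I := by
    suffices h : ∃ J, I₀ ≤ J ∧ Maximal (· ∈ {J : Ideal A | ¬ J.FG}) J from
      h.imp fun J hJ ↦ hJ.2
    refine zorn_le_nonempty₀ {J : Ideal A | ¬ J.FG} ?_ I₀ hI₀
    intro C hC₁ hC₂ I hI
    refine ⟨sSup C, ?_, fun _ ↦ le_sSup⟩
    rintro ⟨G, hG⟩
    obtain ⟨J, hJC, hGJ⟩ : ∃ J ∈ C, (G : Set A) ⊆ J := by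
      refine hC₂.directedOn.exists_mem_subset_of_finset_subset_biUnion ⟨I, hI⟩ (fun _ hx ↦ ?_)
      simp only [Set.mem_iUnion, SetLike.mem_coe, exists_prop]
      exact (Submodule.mem_sSup_of_directed ⟨I, hI⟩ hC₂.directedOn).1 <|
        hG ▸ Submodule.subset_span hx
    have hJ : J = sSup C := le_antisymm (le_sSup hJC) (hG ▸ Ideal.span_le.2 hGJ)
    exact hC₁ hJC (hJ ▸ ⟨G, hG⟩)
  have hprime : I.IsPrime := Ideal.isOka_fg.isPrime_of_maximal_not hI
  have hIM : I ≤ maximalIdeal A := le_maximalIdeal hprime.ne_top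
  obtain ⟨x, hxM, hxI⟩ : ∃ x ∈ maximalIdeal A, x ∉ I := by
    by_contra! h
    exact hI.prop (le_antisymm hIM h ▸ hM)
  have hsup : (I ⊔ Ideal.span {x}).FG := by
    by_contra h
    exact hxI (hI.le_of_ge h le_sup_left (Ideal.mem_sup_right (Ideal.mem_span_singleton_self x)))
  obtain ⟨I', hI'I, hI', hle⟩ : ∃ I' ≤ I, I'.FG ∧ I ⊔ Ideal.span {x} ≤ I' ⊔ Ideal.span {x} := by
    classical
    obtain ⟨s, hs⟩ := hsup
    have key (z : A) (hz : z ∈ s) : ∃ p ∈ I, z - p ∈ Ideal.span {x} := by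
      obtain ⟨p, hp, q, hq, rfl⟩ := Submodule.mem_sup.1 (hs.le (Ideal.subset_span hz))
      exact ⟨p, hp, by simpa using hq⟩
    choose! p hp hpx using key
    refine ⟨Ideal.span (s.image p), Ideal.span_le.2 ?_, ⟨_, rfl⟩, hs ▸ Submodule.span_le.2 ?_⟩
    · intro y hy
      obtain ⟨z, hz, rfl⟩ := Finset.mem_image.1 (Finset.mem_coe.1 hy)
      exact hp z hz
    · intro z hz
      rw [← add_sub_cancel (p z) z]
      exact add_mem
        (Ideal.mem_sup_left (Ideal.subset_span (Finset.mem_coe.2 (Finset.mem_image_of_mem p hz))))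
        (Ideal.mem_sup_right (hpx z hz))
  have hpow (n : ℕ) : ∀ y ∈ I, ∃ a ∈ I, y - x ^ n * a ∈ I' := by
    induction n with
    | zero => exact fun y hy ↦ ⟨y, hy, by simp⟩
    | succ n ih =>
      intro y hy
      obtain ⟨a, ha, hya⟩ := ih y hy
      obtain ⟨i, hi, q, hq, hiq⟩ := Submodule.mem_sup.1 (hle (Ideal.mem_sup_left ha))
      obtain ⟨b, rfl⟩ := Ideal.mem_span_singleton'.1 hq
      have hbx : b * x ∈ I := by
        rw [← add_sub_cancel_left i (b * x), hiq]
        exact sub_mem ha (hI'I hi)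
      refine ⟨b, (hprime.mem_or_mem hbx).resolve_right hxI, ?_⟩
      have : y - x ^ (n + 1) * b = (y - x ^ n * a) + x ^ n * i := by
        rw [← hiq]
        ring
      exact this ▸ add_mem hya (I'.mul_mem_left _ hi)
  refine hI.prop (le_antisymm hI'I (fun y hy ↦ hcl I' hI' y fun n ↦ ?_) ▸ hI')
  obtain ⟨a, -, hya⟩ := hpow n y hy
  rw [← sub_add_cancel y (x ^ n * a)]
  exact add_mem (Ideal.mem_sup_left hya)
    (Ideal.mem_sup_right (Ideal.mul_mem_right _ _ (Ideal.pow_mem_pow hxM n)))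

/-- Krull's intersection theorem descended along a flat local homomorphism with noetherian
source. -/
theorem mem_of_forall_mem_map_sup_pow {B A : Type*} [CommRing B] [CommRing A] [IsLocalRing B]
    [IsLocalRing A] [IsNoetherianRing B] (φ : B →+* A) (hφ : φ.Flat) [IsLocalHom φ]
    (J K : Ideal B) (hK : K ≤ maximalIdeal B) (x : B)
    (hx : ∀ n : ℕ, φ x ∈ J.map φ ⊔ K.map φ ^ n) : x ∈ J := by
  algebraize [φ]
  have : IsLocalHom (algebraMap B A) := ‹IsLocalHom φ›
  have : Module.FaithfullyFlat B A := Module.FaithfullyFlat.of_flat_of_isLocalHom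
  have hx' (n : ℕ) : x ∈ J ⊔ K ^ n := by
    rw [← Ideal.comap_map_eq_self_of_faithfullyFlat (B := A) (J ⊔ K ^ n), Ideal.mem_comap,
      Ideal.map_sup, Ideal.map_pow]
    exact hx n
  rw [← Submodule.Quotient.mk_eq_zero J, ← Submodule.mem_bot B,
    ← Ideal.iInf_pow_smul_eq_bot_of_le_jacobson (M := B ⧸ J) K
      (hK.trans (maximalIdeal_le_jacobson _)), Submodule.mem_iInf]
  intro n
  obtain ⟨y, hy, z, hz, rfl⟩ := Submodule.mem_sup.1 (hx' n)
  rw [Submodule.Quotient.mk_add, (Submodule.Quotient.mk_eq_zero J).2 hy, zero_add]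
  have := Submodule.smul_mem_smul hz (Submodule.mem_top (x := (1 : B ⧸ J)) (R := B))
  rwa [Algebra.smul_def, mul_one] at this

/-- Krull's intersection theorem descended along the localization of a flat homomorphism with
noetherian source. -/
theorem algebraMap_mem_of_forall_mem_sup_pow {R' R : Type*} [CommRing R'] [CommRing R]
    [IsNoetherianRing R'] (f : R' →+* R) (hf : f.Flat) (P : Ideal R) [P.IsPrime] (J N : Ideal R')
    (hN : N ≤ P.comap f) (x : R')
    (hx : ∀ n : ℕ, algebraMap R (Localization.AtPrime P) (f x) ∈
      (J.map f).map (algebraMap R (Localization.AtPrime P)) ⊔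
        (N.map f).map (algebraMap R (Localization.AtPrime P)) ^ n) :
    algebraMap R (Localization.AtPrime P) (f x) ∈
      (J.map f).map (algebraMap R (Localization.AtPrime P)) := by
  let Q := P.comap f
  let φ := Localization.localRingHom Q P f rfl
  have hφf (y) : φ (algebraMap _ _ y) = algebraMap _ _ (f y) :=
    Localization.localRingHom_to_map Q P f rfl y
  have hmap (I : Ideal R') : (I.map f).map (algebraMap R (Localization.AtPrime P)) =
      (I.map (algebraMap R' (Localization.AtPrime Q))).map φ := by
    rw [Ideal.map_map, Ideal.map_map]
    exact congrArg (Ideal.map · I) (RingHom.ext fun y ↦ (hφf y).symm)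
  have hle : N.map (algebraMap R' (Localization.AtPrime Q)) ≤
      maximalIdeal (Localization.AtPrime Q) := by
    rw [← Localization.AtPrime.map_eq_maximalIdeal (I := Q)]
    exact Ideal.map_mono hN
  simp only [hmap, ← hφf] at hx ⊢
  exact Ideal.mem_map_of_mem φ
    (mem_of_forall_mem_map_sup_pow φ (hf.localRingHom P Q rfl) _ _ hle _ hx)

/-- Finitely many elements of `S ⊗[k] L` are defined over a finitely generated subextension. -/
theorem exists_fg_intermediateField_subset_range {k L : Type*} (S : Type*) [Field k] [Field L]
    [Algebra k L] [CommRing S] [Algebra k S] (T : Finset (S ⊗[k] L)) :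
    ∃ F : IntermediateField k L, F.FG ∧
      (T : Set (S ⊗[k] L)) ⊆ (Algebra.TensorProduct.map (AlgHom.id k S) F.val).range := by
  classical
  have hmono {F G : IntermediateField k L} (h : F ≤ G) :
      (Algebra.TensorProduct.map (AlgHom.id k S) F.val).range ≤
        (Algebra.TensorProduct.map (AlgHom.id k S) G.val).range := by
    rintro _ ⟨z, rfl⟩
    refine ⟨Algebra.TensorProduct.map (AlgHom.id k S) (IntermediateField.inclusion h) z, ?_⟩
    induction z with
    | zero => simp
    | add a b ha hb => simp only [map_add, ha, hb]
    | tmul a b => rfl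
  have hone (z : S ⊗[k] L) : ∃ F : IntermediateField k L, F.FG ∧
      z ∈ (Algebra.TensorProduct.map (AlgHom.id k S) F.val).range := by
    induction z with
    | zero => exact ⟨⊥, IntermediateField.fg_bot, zero_mem _⟩
    | add a b ha hb =>
      obtain ⟨F, hF, ha⟩ := ha
      obtain ⟨G, hG, hb⟩ := hb
      exact ⟨F ⊔ G, IntermediateField.fg_sup hF hG,
        add_mem (hmono le_sup_left ha) (hmono le_sup_right hb)⟩
    | tmul s l =>
      refine ⟨IntermediateField.adjoin k ({l} : Finset L),
        IntermediateField.fg_adjoin_finset _,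
        s ⊗ₜ ⟨l, IntermediateField.subset_adjoin k _ (by simp)⟩, rfl⟩
  induction T using Finset.induction_on with
  | empty => exact ⟨⊥, IntermediateField.fg_bot, by simp⟩
  | insert a T _ ih =>
    obtain ⟨F, hF, hT⟩ := ih
    obtain ⟨G, hG, ha⟩ := hone a
    refine ⟨F ⊔ G, IntermediateField.fg_sup hF hG, ?_⟩
    rw [Finset.coe_insert, Set.insert_subset_iff]
    exact ⟨hmono le_sup_right ha, fun t ht ↦ hmono le_sup_left (hT ht)⟩

/-- The extended maximal ideal is the kernel of `S ⊗[k₀] L → k ⊗[k₀] L`. -/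
theorem extendedMaxIdeal_eq_ker (k₀ S L : Type*) [Field k₀] [CommRing S] [Algebra k₀ S]
    [IsLocalRing S] [CommRing L] [Algebra k₀ L] :
    extendedMaxIdeal k₀ S L = RingHom.ker (Algebra.TensorProduct.map
      (Ideal.Quotient.mkₐ k₀ (maximalIdeal S)) (AlgHom.id k₀ L)) := by
  rw [Algebra.TensorProduct.rTensor_ker _ (Ideal.Quotient.mkₐ_surjective _ _)]
  exact congrArg _ (Ideal.Quotient.mkₐ_ker k₀ _).symm

/-- If `k ⊗[k₀] L` is a domain (`k` the residue field of `S`), then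
`m·(S ⊗[k₀] L)` is prime and the localization of `S ⊗[k₀] L` at it is a noetherian local
ring. -/
theorem extendedMaxIdeal_isPrime_and_localization_noetherian_local
    (k₀ S L : Type*) [Field k₀] [Field L] [Algebra k₀ L]
    [CommRing S] [Algebra k₀ S] [IsNoetherianRing S] [IsLocalRing S]
    (hdom : IsDomain ((S ⧸ maximalIdeal S) ⊗[k₀] L)) :
    ∃ hp : (extendedMaxIdeal k₀ S L).IsPrime,
      IsNoetherianRing (Localization (@Ideal.primeCompl _ _ (extendedMaxIdeal k₀ S L) hp)) ∧
      IsLocalRing (Localization (@Ideal.primeCompl _ _ (extendedMaxIdeal k₀ S L) hp)) := by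
  have hp : (extendedMaxIdeal k₀ S L).IsPrime := by
    rw [extendedMaxIdeal_eq_ker]
    exact RingHom.ker_isPrime _
  have hloc : IsLocalRing (Localization (extendedMaxIdeal k₀ S L).primeCompl) :=
    Localization.AtPrime.isLocalRing (extendedMaxIdeal k₀ S L)
  refine ⟨hp, ?_, hloc⟩
  set P := extendedMaxIdeal k₀ S L with hP
  let A := Localization.AtPrime P
  have hmax : maximalIdeal A = P.map (algebraMap _ A) :=
    (Localization.AtPrime.map_eq_maximalIdeal (I := P)).symm
  change IsNoetherianRing A
  refine isNoetherianRing_of_fg_ideal_closed ?_ ?_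
  · rw [hmax]
    exact Ideal.FG.map (Ideal.FG.map (IsNoetherian.noetherian (maximalIdeal S)) _) _
  rintro _ ⟨s, rfl⟩ a ha
  have hnum (z : A) : ∃ r : S ⊗[k₀] L, Associated z (algebraMap _ A r) := by
    obtain ⟨⟨r, u⟩, h⟩ := IsLocalization.surj P.primeCompl z
    exact ⟨r, (IsLocalization.map_units A u).unit, h⟩
  choose num hnum using hnum
  classical
  obtain ⟨F, hF, hT⟩ := exists_fg_intermediateField_subset_range S (insert (num a) (s.image num))
  let f := (Algebra.TensorProduct.map (AlgHom.id k₀ S) F.val).toRingHom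
  have hf : f.Flat := RingHom.Flat.tensorProductMap (RingHom.Flat.id S)
    (RingHom.Flat.of_isField (Field.toIsField F) _)
  have : Algebra.EssFiniteType k₀ F := IntermediateField.essFiniteType_iff.2 hF
  have : IsNoetherianRing (S ⊗[k₀] F) := Algebra.EssFiniteType.isNoetherianRing S (S ⊗[k₀] F)
  let N : Ideal (S ⊗[k₀] F) := (maximalIdeal S).map
    (Algebra.TensorProduct.includeLeft : S →ₐ[k₀] S ⊗[k₀] F).toRingHom
  have hNf : N.map f = P := by
    rw [Ideal.map_map, hP, extendedMaxIdeal]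
    congr 1
  have hlift (z : A) (hz : z ∈ insert a s) :
      ∃ y : S ⊗[k₀] F, Associated z (algebraMap _ A (f y)) := by
    obtain ⟨y, hy⟩ : num z ∈ (Algebra.TensorProduct.map (AlgHom.id k₀ S) F.val).range := by
      apply hT
      rw [← Finset.image_insert]
      exact Finset.mem_coe.2 (Finset.mem_image_of_mem num hz)
    exact ⟨y, (show f y = num z from hy) ▸ hnum z⟩
  choose! lift hlift using hlift
  have hassoc {I : Ideal A} {x y : A} (h : Associated x y) : x ∈ I ↔ y ∈ I :=
    ⟨I.mem_of_dvd h.dvd, I.mem_of_dvd h.symm.dvd⟩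
  have hspan : Ideal.span (s : Set A) =
      ((Ideal.span (lift '' s)).map f).map (algebraMap _ A) := by
    rw [Ideal.map_span, Ideal.map_span]
    apply le_antisymm
    · refine Ideal.span_le.2 fun z hz ↦ ?_
      rw [SetLike.mem_coe, hassoc (hlift z (Finset.mem_insert_of_mem hz))]
      exact Ideal.subset_span ⟨_, ⟨_, ⟨z, hz, rfl⟩, rfl⟩, rfl⟩
    · rw [Ideal.span_le]
      rintro _ ⟨_, ⟨_, ⟨z, hz, rfl⟩, rfl⟩, rfl⟩
      rw [SetLike.mem_coe, ← hassoc (hlift z (Finset.mem_insert_of_mem hz))]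
      exact Ideal.subset_span hz
  have hla := hlift a (Finset.mem_insert_self a s)
  change a ∈ Ideal.span (s : Set A)
  rw [hassoc hla, hspan]
  refine algebraMap_mem_of_forall_mem_sup_pow f hf P _ N (Ideal.map_le_iff_le_comap.1 hNf.le) _
    fun n ↦ ?_
  rw [← hspan, hNf, ← hmax, ← hassoc hla]
  exact ha n
end

section
/- Let (R, m) be a noetherian local domain with field of fractions K, and let R' be the integral closure of R in K. Assume that R' is finite as an R-module and is a local ring. Let R̂ denote the m-adic completion of R and consider R̂' := R' ⊗_R R̂ with the natural maps R' → R̂' and R̂ → R̂'. Assume that R̂' is an integral domain and that R' is algebraically closed in R̂' (every element of R̂' which is a root of a nonzero polynomial with coefficients in R' lies in the image of R'). Then R̂ is an integral domain (R is analytically irreducible) and R is algebraically closed in R̂ (every element of R̂ which is a root of a nonzero polynomial with coefficients in R lies in the image of R). -/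
/-!
Statement 18. Let `(R, m)` be a noetherian local domain with fraction field `K` and let `R'`
be the integral closure of `R` in `K` (the normalization).  Assume `R'` is finite as an
`R`-module and local.  Let `R̂` be the `m`-adic completion of `R` and `R̂' = R' ⊗[R] R̂`
(which is the completion of `R'`, since `R'` is module-finite over `R`).  If `R̂'` is a
domain and `R'` is algebraically closed in `R̂'`, then `R̂` is a domain (`R` is analytically
irreducible) and `R` is algebraically closed in `R̂`.
-/

set_option synthInstance.maxHeartbeats 800000
set_option maxHeartbeats 1600000

open IsLocalRing
open scoped TensorProduct

/-- In a faithfully flat algebra that is a domain, an element which becomes a fraction of elements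
of the base already lies in the base. -/
theorem Module.FaithfullyFlat.exists_algebraMap_eq_of_mul_eq {R S : Type*} [CommRing R] [CommRing S]
    [IsDomain S] [Algebra R S] [Module.FaithfullyFlat R S] {a b : R} (hb : b ≠ 0) {x : S}
    (h : algebraMap R S b * x = algebraMap R S a) : ∃ y : R, algebraMap R S y = x := by
  have ha : a ∈ Ideal.span {b} := by
    rw [← Ideal.comap_map_eq_self_of_faithfullyFlat (B := S) (Ideal.span {b}), Ideal.mem_comap,
      Ideal.map_span, Set.image_singleton, Ideal.mem_span_singleton]
    exact ⟨x, h.symm⟩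
  obtain ⟨c, rfl⟩ := Ideal.mem_span_singleton.mp ha
  rw [map_mul] at h
  have hb' : algebraMap R S b ≠ 0 :=
    (map_ne_zero_iff _ (FaithfulSMul.algebraMap_injective R S)).mpr hb
  exact ⟨c, (mul_left_cancel₀ hb' h).symm⟩

/-- Analytic irreducibility and algebraic closedness in the completion
descend from the normalization. -/
theorem analyticallyIrreducible_and_algClosed_in_completion
    (R : Type*) [CommRing R] [IsDomain R] [IsNoetherianRing R] [IsLocalRing R]
    [Module.Finite R (integralClosure R (FractionRing R))]
    [IsLocalRing (integralClosure R (FractionRing R))]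
    (hdom : IsDomain ((integralClosure R (FractionRing R)) ⊗[R]
        (AdicCompletion (maximalIdeal R) R)))
    (halg : ∀ x : (integralClosure R (FractionRing R)) ⊗[R]
          (AdicCompletion (maximalIdeal R) R),
        (∃ p : Polynomial (integralClosure R (FractionRing R)), p ≠ 0 ∧
          Polynomial.eval₂
            (Algebra.TensorProduct.includeLeft :
              (integralClosure R (FractionRing R)) →ₐ[R]
                (integralClosure R (FractionRing R)) ⊗[R]
                  (AdicCompletion (maximalIdeal R) R)).toRingHom x p = 0) →
        ∃ y : integralClosure R (FractionRing R),
          (Algebra.TensorProduct.includeLeft :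
              (integralClosure R (FractionRing R)) →ₐ[R]
                (integralClosure R (FractionRing R)) ⊗[R]
                  (AdicCompletion (maximalIdeal R) R)) y = x) :
    IsDomain (AdicCompletion (maximalIdeal R) R) ∧
    ∀ x : AdicCompletion (maximalIdeal R) R,
      (∃ p : Polynomial R, p ≠ 0 ∧
        Polynomial.eval₂ (algebraMap R (AdicCompletion (maximalIdeal R) R)) x p = 0) →
      ∃ y : R, algebraMap R (AdicCompletion (maximalIdeal R) R) y = x := by
  set Rhat := AdicCompletion (maximalIdeal R) R
  set R' := integralClosure R (FractionRing R)
  have hff : Module.FaithfullyFlat R Rhat := Module.FaithfullyFlat.of_flat_of_isLocalHom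
  have hR' : Function.Injective (algebraMap R R') := FaithfulSMul.algebraMap_injective R R'
  have hinj : Function.Injective
      (Algebra.TensorProduct.includeRight : Rhat →ₐ[R] R' ⊗[R] Rhat) :=
    Algebra.TensorProduct.includeRight_injective hR'
  have hRhat : IsDomain Rhat := hinj.isDomain
    (Algebra.TensorProduct.includeRight : Rhat →ₐ[R] R' ⊗[R] Rhat).toRingHom
  refine ⟨hRhat, ?_⟩
  rintro x ⟨p, hp, hpx⟩
  obtain ⟨y, hy⟩ := halg ((Algebra.TensorProduct.includeRight : Rhat →ₐ[R] R' ⊗[R] Rhat) x)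
    ⟨p.map (algebraMap R R'), (Polynomial.map_ne_zero_iff hR').mpr hp, by
      rw [Polynomial.eval₂_map]
      change Polynomial.eval₂ ((Algebra.TensorProduct.includeLeft :
        R' →ₐ[R] R' ⊗[R] Rhat).toRingHom.comp (algebraMap R R')) _ p = 0
      rw [AlgHom.toRingHom_eq_coe, AlgHom.comp_algebraMap, ← Polynomial.aeval_def,
        Polynomial.aeval_algHom_apply, Polynomial.aeval_def, hpx, map_zero]⟩
  obtain ⟨a, b, hb, hab⟩ := IsFractionRing.div_surjective (A := R) (y : FractionRing R)
  have hb0 : b ≠ 0 := nonZeroDivisors.ne_zero hb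
  have hby : algebraMap R R' b * y = algebraMap R R' a := by
    apply Subtype.ext
    change algebraMap R (FractionRing R) b * (y : FractionRing R) = algebraMap R (FractionRing R) a
    rw [← hab, mul_div_cancel₀]
    exact (map_ne_zero_iff _ (IsFractionRing.injective R (FractionRing R))).mpr hb0
  refine Module.FaithfullyFlat.exists_algebraMap_eq_of_mul_eq (a := a) hb0 (hinj ?_)
  rw [map_mul, AlgHom.commutes, AlgHom.commutes, ← hy,
    ← AlgHom.commutes (Algebra.TensorProduct.includeLeft : R' →ₐ[R] R' ⊗[R] Rhat) b, ← map_mul,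
    hby, AlgHom.commutes]
end
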